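/- For every integer rho with rho_{p} <= rho <= r-1: (1) the minimal function f^rho_{p} is admissible, hence rho_{p} is the minimal regularity among admissible functions with Hilbert polynomial p(z); (2) f^rho_{p}(t) >= f^{rho+1}_{p}(t) for all t; (3) f^rho_{p} is the pointwise-minimal admissible function with Hilbert polynomial p(z) and regularity at most rho; (4) f^{rho_{p}}_{p} has regularity exactly rho_{p}; (5) if rho > rho_{p}, then f^rho_{p}(rho-1) <= p(rho-1). -/

import Mathlib

open scoped Classical

noncomputable section

/-! ## Binomial expansions and the Macaulay operations `(a_t)^+_+` and `(a_t)^-_-` -/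

/-- The largest `k` such that `C(k,t) ≤ a` (top coefficient of the greedy binomial
expansion of `a` in base `t`). -/
def expTop (a t : ℕ) : ℕ := Nat.findGreatest (fun k => Nat.choose k t ≤ a) (a + t + 1)

/-- `(a_t)^+_+` : if `a = C(k(t),t) + ... + C(k(j),j)` is the binomial expansion of `a`
in base `t`, then `plusPlus a t = C(k(t)+1,t+1) + ... + C(k(j)+1,j+1)`; it sends `0` to `0`. -/
def plusPlus : ℕ → ℕ → ℕ
  | _, 0 => 0
  | a, t + 1 =>
    if a = 0 then 0
    else Nat.choose (expTop a (t + 1) + 1) (t + 2) +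
      plusPlus (a - Nat.choose (expTop a (t + 1)) (t + 1)) t

/-- `(a_t)^-_-` : if `a = C(k(t),t) + ... + C(k(j),j)` is the binomial expansion of `a`
in base `t`, then `minusMinus a t = C(k(t)-1,t-1) + ... + C(k(j)-1,j-1)`; it sends `0` to `0`. -/
def minusMinus : ℕ → ℕ → ℕ
  | _, 0 => 0
  | a, t + 1 =>
    if a = 0 then 0
    else Nat.choose (expTop a (t + 1) - 1) t +
      minusMinus (a - Nat.choose (expTop a (t + 1)) (t + 1)) t

/-! ## Numerical functions -/

/-- A numerical function (modelled with values in `ℤ`) is *admissible* (an O-sequence) if it is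
nonnegative, `H 0 = 1` and `H (t+1) ≤ (H(t)_t)^+_+` for every `t ≥ 1`. -/
def OSeq (H : ℕ → ℤ) : Prop :=
  (∀ t, 0 ≤ H t) ∧ H 0 = 1 ∧ ∀ t, 1 ≤ t → H (t + 1) ≤ (plusPlus (H t).toNat t : ℤ)

/-- First derivative of a numerical function: `Δf(0) = 1`, `Δf(t) = f(t) - f(t-1)`. -/
def nderiv (f : ℕ → ℤ) : ℕ → ℤ
  | 0 => 1
  | t + 1 => f (t + 1) - f t

/-- Integral of a numerical function: `Σg(0) = 1`, `Σg(t) = Σg(t-1) + g(t)`. -/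
def ninteg (g : ℕ → ℤ) : ℕ → ℤ
  | 0 => 1
  | t + 1 => ninteg g t + g (t + 1)

/-! ## Admissible Hilbert polynomials in Gotzmann form -/

/-- The integer-valued binomial coefficient `C(a,k)` for `a : ℤ`, agreeing with the
polynomial binomial coefficient `a(a-1)⋯(a-k+1)/k!`. -/
def zchoose (a : ℤ) (k : ℕ) : ℤ :=
  if 0 ≤ a then (a.toNat.choose k : ℤ)
  else (-1) ^ k * (((k : ℤ) - 1 - a).toNat.choose k : ℤ)

/-- An admissible Hilbert polynomial, recorded through its Gotzmann form
`p(z) = C(z+k₁,k₁) + C(z+k₂-1,k₂) + ... + C(z+k_r-(r-1),k_r)` with `k₁ ≥ k₂ ≥ ... ≥ k_r ≥ 0`. -/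
structure GotzmannPoly where
  ks : List ℕ
  sorted : ks.Pairwise (· ≥ ·)

namespace GotzmannPoly

/-- The Gotzmann number `r` of `p`. -/
def r (p : GotzmannPoly) : ℕ := p.ks.length

/-- The degree of `p`, namely `k₁`. -/
def degree (p : GotzmannPoly) : ℕ := p.ks.headD 0

/-- Evaluation of `p` at an integer. -/
def eval (p : GotzmannPoly) (z : ℤ) : ℤ :=
  ∑ i ∈ Finset.range p.r, zchoose (z + (p.ks.getD i 0 : ℤ) - i) (p.ks.getD i 0)

/-- The first difference `Δp(z) = p(z) - p(z-1)`, in Gotzmann form. -/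
def delta (p : GotzmannPoly) : GotzmannPoly where
  ks := (p.ks.filter fun k => 1 ≤ k).map fun k => k - 1
  sorted := by
    refine List.Pairwise.map _ (fun {a b} h => Nat.sub_le_sub_right h 1) ?_
    exact p.sorted.filter _

/-- Iterated first difference `Δ^i p`. -/
def deltaIter (p : GotzmannPoly) (i : ℕ) : GotzmannPoly := delta^[i] p

/-- The polynomial `p(z) + c`, in Gotzmann form. -/
def addConst (p : GotzmannPoly) (c : ℕ) : GotzmannPoly where
  ks := p.ks ++ List.replicate c 0
  sorted := by
    rw [List.pairwise_append]
    refine ⟨p.sorted, ?_, ?_⟩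
    · exact List.pairwise_replicate.2 (Or.inr le_rfl)
    · intro a _ b hb
      rw [List.eq_of_mem_replicate hb]
      exact Nat.zero_le a

end GotzmannPoly

/-- The set `Π_p = {1 ≤ t ≤ r : (p(t+h)_{t+h})^+_+ ≥ p(t+h+1) ≥ 1 for all h ≥ 0}`. -/
def PiSet (p : GotzmannPoly) : Set ℕ :=
  {t | 1 ≤ t ∧ t ≤ p.r ∧ ∀ h : ℕ,
      p.eval ((t : ℤ) + (h : ℤ) + 1) ≤ (plusPlus (p.eval ((t : ℤ) + (h : ℤ))).toNat (t + h) : ℤ) ∧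
      1 ≤ p.eval ((t : ℤ) + (h : ℤ) + 1)}

/-- `ρ_p`: `0` if `min Π_p = 1` and `p(0) = 1`, and `min Π_p` otherwise. -/
def rhoP (p : GotzmannPoly) : ℕ :=
  if sInf (PiSet p) = 1 ∧ p.eval 0 = 1 then 0 else sInf (PiSet p)

/-- The minimal function `f^ρ_p` : `f(t) = p(t)` for `t ≥ ρ` and
`f(t) = ((f(t+1))_{t+1})^-_-` for `t < ρ`. -/
def fmin (p : GotzmannPoly) (ρ : ℕ) (t : ℕ) : ℤ :=
  if h : ρ ≤ t then p.eval (t : ℤ)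
  else (minusMinus (fmin p ρ (t + 1)).toNat (t + 1) : ℤ)
termination_by ρ - t
decreasing_by omega

/-- The function `g^ρ_p` : `g(t) = p(t)` for `t ≥ ρ`, `g(ρ-1) = p(ρ-1) + 1` and
`g(t) = ((g(t+1))_{t+1})^-_-` for `t < ρ-1`. -/
def gmin (p : GotzmannPoly) (ρ : ℕ) (t : ℕ) : ℤ :=
  if h : ρ ≤ t then p.eval (t : ℤ)
  else if t = ρ - 1 then p.eval (t : ℤ) + 1
  else (minusMinus (gmin p ρ (t + 1)).toNat (t + 1) : ℤ)
termination_by ρ - t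
decreasing_by omega

/-- `H` has regularity `ρ` (with respect to the Hilbert polynomial `p`): `ρ` is the least
integer such that `H(t) = p(t)` for all `t ≥ ρ`. -/
def IsRegOf (p : GotzmannPoly) (H : ℕ → ℤ) (ρ : ℕ) : Prop :=
  (∀ t : ℕ, ρ ≤ t → H t = p.eval (t : ℤ)) ∧
  ∀ ρ' : ℕ, (∀ t : ℕ, ρ' ≤ t → H t = p.eval (t : ℤ)) → ρ ≤ ρ'

/-- `H` has Hilbert polynomial `p`, i.e. eventually agrees with `p`. -/
def HasHP (p : GotzmannPoly) (H : ℕ → ℤ) : Prop :=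
  ∃ N : ℕ, ∀ t : ℕ, N ≤ t → H t = p.eval (t : ℤ)

/-- `F(p,ρ)`: the set of Hilbert functions of closed projective subschemes (i.e. numerical
functions which are admissible together with their first derivative) with Hilbert
polynomial `p` and regularity `ρ`. -/
def Fset (p : GotzmannPoly) (ρ : ℕ) : Set (ℕ → ℤ) :=
  {H | OSeq H ∧ OSeq (nderiv H) ∧ IsRegOf p H ρ}

/-- `ρ̄_p`: the minimal `ρ` such that `F(p,ρ)` is non-empty. -/
def rhobar (p : GotzmannPoly) : ℕ := sInf {ρ | (Fset p ρ).Nonempty}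

/-! ## Monomial ideals in `K[x₀,…,xₙ]` (combinatorial model) -/

/-- Monomials of `K[x₀,…,xₙ]`, as exponent vectors. -/
abbrev Mon (n : ℕ) := Fin (n + 1) → ℕ

/-- Degree of a monomial. -/
def mdeg {n : ℕ} (m : Mon n) : ℕ := ∑ i, m i

/-- `T_t`, the set of terms of degree `t`. -/
def Tset (n t : ℕ) : Set (Mon n) := {m | mdeg m = t}

/-- A set of monomials closed under multiplication by arbitrary monomials (a monomial ideal). -/
def MonIdeal {n : ℕ} (J : Set (Mon n)) : Prop :=
  ∀ m ∈ J, ∀ m' : Mon n, m + m' ∈ J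

/-- The elementary Borel move sending `x^m` to `x_i · x^m / x_j`. -/
def borelStep {n : ℕ} (m : Mon n) (j i : Fin (n + 1)) : Mon n :=
  fun l => if l = j then m l - 1 else if l = i then m l + 1 else m l

/-- One elementary Borel move `x_j ↦ x_i` with `j < i`. -/
def borelMove {n : ℕ} (a b : Mon n) : Prop :=
  ∃ j i : Fin (n + 1), j < i ∧ 1 ≤ a j ∧ b = borelStep a j i

/-- The Borel (partial) order `≤_B` on monomials. -/
def borelLE {n : ℕ} : Mon n → Mon n → Prop := Relation.ReflTransGen borelMove

/-- A strongly stable (Borel) monomial ideal. -/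
def StronglyStable {n : ℕ} (J : Set (Mon n)) : Prop :=
  MonIdeal J ∧ ∀ m ∈ J, ∀ j i : Fin (n + 1), j < i → 1 ≤ m j → borelStep m j i ∈ J

/-- A Borel set in `T_t`: a set of degree-`t` monomials closed upwards under `≤_B`. -/
def IsBorelSet {n : ℕ} (t : ℕ) (B : Set (Mon n)) : Prop :=
  B ⊆ Tset n t ∧ ∀ a ∈ B, ∀ b : Mon n, borelLE a b → b ∈ B

/-- Saturation of a monomial ideal:
`J^sat = {m : for every i there is k with x_i^k · m ∈ J}`. -/
def monSat {n : ℕ} (J : Set (Mon n)) : Set (Mon n) :=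
  {m | ∀ i : Fin (n + 1), ∃ k : ℕ, (fun l => if l = i then m l + k else m l) ∈ J}

/-- The monomial ideal generated by a set of monomials. -/
def genIdeal {n : ℕ} (B : Set (Mon n)) : Set (Mon n) :=
  {m | ∃ b ∈ B, ∃ c : Mon n, m = b + c}

/-- The Hilbert function of `S/J` for a monomial ideal `J`: the number of degree-`t`
monomials outside `J`. -/
def hilb {n : ℕ} (J : Set (Mon n)) (t : ℕ) : ℕ :=
  Set.ncard {m : Mon n | mdeg m = t ∧ m ∉ J}

/-- `m / x_i` as an exponent vector. -/
def shrinkAt {n : ℕ} (m : Mon n) (i : Fin (n + 1)) : Mon n :=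
  fun l => if l = i then m l - 1 else m l

/-- `m` is a minimal (monomial) generator of the monomial ideal `J`. -/
def IsMinGen {n : ℕ} (J : Set (Mon n)) (m : Mon n) : Prop :=
  m ∈ J ∧ ∀ i : Fin (n + 1), 1 ≤ m i → shrinkAt m i ∉ J

/-- The Castelnuovo–Mumford regularity of a strongly stable ideal: the maximal degree of a
minimal monomial generator. -/
def monReg {n : ℕ} (J : Set (Mon n)) : ℕ :=
  sSup {d | ∃ m : Mon n, IsMinGen J m ∧ mdeg m = d}

/-- `m_u`: the minimal Castelnuovo–Mumford regularity of a closed projective subscheme with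
Hilbert function `u`, i.e. the minimum of `reg J` over all `n` and all saturated strongly
stable ideals `J ⊆ K[x₀,…,xₙ]` with `H_{S/J} = u`. -/
def mReg (u : ℕ → ℤ) : ℕ :=
  sInf {r | ∃ (n : ℕ) (J : Set (Mon n)), StronglyStable J ∧ monSat J = J ∧
      (∀ t : ℕ, (hilb J t : ℤ) = u t) ∧ monReg J = r}

/-- `M(p,ρ) = {m_u : u ∈ F(p,ρ)}`. -/
def Mset (p : GotzmannPoly) (ρ : ℕ) : Set ℕ := {r | ∃ u ∈ Fset p ρ, mReg u = r}

/-- `m^ρ_p = min M(p,ρ)`. -/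
def mRho (p : GotzmannPoly) (ρ : ℕ) : ℕ := sInf (Mset p ρ)

/-- `m_p`: the minimal Castelnuovo–Mumford regularity of schemes with Hilbert polynomial `p`. -/
def mP (p : GotzmannPoly) : ℕ := sInf {r | ∃ ρ : ℕ, ∃ u ∈ Fset p ρ, mReg u = r}

/-! ## Lex segments and growth-height-lexicographic Borel sets -/

/-- `a` is smaller than `b` in the deglex order (for monomials of the same degree):
`a k < b k` where `k` is the largest index where they differ. -/
def deglexLT {n : ℕ} (a b : Mon n) : Prop :=
  ∃ k : Fin (n + 1), a k < b k ∧ ∀ l : Fin (n + 1), k < l → a l = b l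

/-- A lex-segment of `T_t`: a set of degree-`t` monomials consisting of the highest terms
with respect to deglex. -/
def IsLexSeg {n : ℕ} (t : ℕ) (L : Set (Mon n)) : Prop :=
  L ⊆ Tset n t ∧ ∀ a ∈ L, ∀ b ∈ Tset n t, deglexLT a b → b ∈ L

/-- A lex-segment in `A ⊆ T_t`: the intersection of a lex-segment of `T_t` with `A`. -/
def LexSegIn {n : ℕ} (t : ℕ) (A S : Set (Mon n)) : Prop :=
  ∃ L : Set (Mon n), IsLexSeg t L ∧ S = L ∩ A

/-- The growth class `B^{(i)} = {m ∈ B : min(m) = i}`. -/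
def growthClass {n : ℕ} (B : Set (Mon n)) (i : Fin (n + 1)) : Set (Mon n) :=
  {m | m ∈ B ∧ 1 ≤ m i ∧ ∀ j : Fin (n + 1), j < i → m j = 0}

/-- The height class `B(i) = {m ∈ B : the exponent of x₀ in m is i}`. -/
def heightClass {n : ℕ} (B : Set (Mon n)) (i : ℕ) : Set (Mon n) :=
  {m | m ∈ B ∧ m 0 = i}

/-- A Borel set `B ⊆ T_t` is growth-lexicographic if all its growth classes are lex-segments
in the corresponding growth classes of `T_t`. -/
def GrowthLex {n : ℕ} (t : ℕ) (B : Set (Mon n)) : Prop :=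
  ∀ i : Fin (n + 1), LexSegIn t (growthClass (Tset n t) i) (growthClass B i)

/-- A Borel set `B ⊆ T_t` is growth-height-lexicographic if `B(0)` is growth-lexicographic
and `B(i)` is a lex-segment in `T_t(i)` for every `0 < i ≤ t`. -/
def GHLex {n : ℕ} (t : ℕ) (B : Set (Mon n)) : Prop :=
  GrowthLex t (heightClass B 0) ∧
  ∀ i : ℕ, 0 < i → i ≤ t → LexSegIn t (heightClass (Tset n t) i) (heightClass B i)

end

/-! ### The Macaulay operations -/

theorem lt_choose_succ_add (a t : ℕ) : a < Nat.choose (a + t + 1) (t + 1) := by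
  induction t with
  | zero => simp
  | succ t ih =>
    have h : a + (t + 1) + 1 = (a + t + 1) + 1 := by ring
    rw [h, Nat.choose_succ_succ]
    omega

theorem choose_expTop_le (a t : ℕ) : Nat.choose (expTop a (t + 1)) (t + 1) ≤ a :=
  Nat.findGreatest_spec (P := fun k => Nat.choose k (t + 1) ≤ a) (m := 0) (Nat.zero_le _)
    (by simp)

theorem lt_choose_expTop_succ (a t : ℕ) : a < Nat.choose (expTop a (t + 1) + 1) (t + 1) := by
  by_contra! h
  rcases le_or_gt (expTop a (t + 1) + 1) (a + (t + 1) + 1) with hk | hk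
  · exact Nat.findGreatest_is_greatest (P := fun k => Nat.choose k (t + 1) ≤ a)
      (Nat.lt_succ_self _) hk h
  · exact absurd (Nat.choose_le_choose (t + 1) (show a + t + 1 ≤ expTop a (t + 1) + 1 by omega))
      (by have := lt_choose_succ_add a t; omega)

theorem lt_of_choose_lt_choose {k m t : ℕ} (h : Nat.choose k t < Nat.choose m t) : k < m :=
  lt_of_not_ge fun hle => absurd (Nat.choose_le_choose t hle) (not_le.2 h)

theorem expTop_choose_add {k s t : ℕ} (hs : s < Nat.choose k t) :
    expTop (Nat.choose k (t + 1) + s) (t + 1) = k := by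
  have h1 := choose_expTop_le (Nat.choose k (t + 1) + s) t
  have h2 := lt_choose_expTop_succ (Nat.choose k (t + 1) + s) t
  have h3 : Nat.choose (k + 1) (t + 1) = Nat.choose k t + Nat.choose k (t + 1) :=
    Nat.choose_succ_succ _ _
  have h4 := lt_of_choose_lt_choose (k := expTop (Nat.choose k (t + 1) + s) (t + 1))
    (m := k + 1) (t := t + 1) (by omega)
  have h5 := lt_of_choose_lt_choose (k := k)
    (m := expTop (Nat.choose k (t + 1) + s) (t + 1) + 1) (t := t + 1) (by omega)
  omega

theorem exists_eq_choose_add (a t : ℕ) :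
    ∃ k s, s < Nat.choose k t ∧ a = Nat.choose k (t + 1) + s := by
  have h1 := choose_expTop_le a t
  have h2 := lt_choose_expTop_succ a t
  rw [Nat.choose_succ_succ] at h2
  exact ⟨expTop a (t + 1), a - Nat.choose (expTop a (t + 1)) (t + 1), by
    simp only [Nat.succ_eq_add_one] at h2; omega, by omega⟩

theorem le_of_lt_choose {k s t : ℕ} (hs : s < Nat.choose k t) : t ≤ k := by
  by_contra! h
  simp [Nat.choose_eq_zero_of_lt h] at hs

theorem plusPlus_zero (t : ℕ) : plusPlus 0 t = 0 := by
  cases t <;> simp [plusPlus]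

theorem minusMinus_zero (t : ℕ) : minusMinus 0 t = 0 := by
  cases t <;> simp [minusMinus]

theorem plusPlus_choose_add {k s t : ℕ} (hs : s < Nat.choose k t) :
    plusPlus (Nat.choose k (t + 1) + s) (t + 1) =
      Nat.choose (k + 1) (t + 2) + plusPlus s t := by
  rcases eq_or_lt_of_le (le_of_lt_choose hs) with rfl | hk
  · obtain rfl : s = 0 := by simpa using hs
    simp [plusPlus_zero]
  · have hpos : 0 < Nat.choose k (t + 1) := Nat.choose_pos hk
    rw [plusPlus, if_neg (by omega), expTop_choose_add hs, Nat.add_sub_cancel_left]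

theorem minusMinus_choose_add {k s t : ℕ} (hs : s < Nat.choose (k + 1) t) (hk : t ≤ k) :
    minusMinus (Nat.choose (k + 1) (t + 1) + s) (t + 1) = Nat.choose k t + minusMinus s t := by
  have hpos : 0 < Nat.choose (k + 1) (t + 1) := Nat.choose_pos (by omega)
  rw [minusMinus, if_neg (by omega), expTop_choose_add hs, Nat.add_sub_cancel_left,
    Nat.add_sub_cancel]

theorem exists_eq_choose_succ_add {a : ℕ} (ha : 0 < a) (t : ℕ) :
    ∃ k s, t ≤ k ∧ s < Nat.choose (k + 1) t ∧ a = Nat.choose (k + 1) (t + 1) + s := by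
  obtain ⟨k, s, hs, rfl⟩ := exists_eq_choose_add a t
  rcases eq_or_lt_of_le (le_of_lt_choose hs) with rfl | hk
  · obtain rfl : s = 0 := by simpa using hs
    simp at ha
  · obtain ⟨k, rfl⟩ : ∃ l, k = l + 1 := ⟨k - 1, by omega⟩
    exact ⟨k, s, by omega, hs, rfl⟩

theorem plusPlus_lt_choose {a m t : ℕ} (h : a < Nat.choose m t) :
    plusPlus a t < Nat.choose (m + 1) (t + 1) := by
  induction t generalizing a m with
  | zero => simp [plusPlus]
  | succ t ih =>
    obtain ⟨k, s, hs, rfl⟩ := exists_eq_choose_add a t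
    have hkm : k < m := lt_of_choose_lt_choose (t := t + 1) (by omega)
    rw [plusPlus_choose_add hs]
    have h1 := ih hs
    have h2 : Nat.choose (k + 2) (t + 2) ≤ Nat.choose (m + 1) (t + 2) :=
      Nat.choose_le_choose _ (by omega)
    have h3 : Nat.choose (k + 2) (t + 2) = Nat.choose (k + 1) (t + 1) + Nat.choose (k + 1) (t + 2) :=
      Nat.choose_succ_succ _ _
    show _ < Nat.choose (m + 1) (t + 2)
    omega

theorem minusMinus_one_le (a : ℕ) : minusMinus a 1 ≤ 1 := by
  by_cases h : a = 0 <;> simp [minusMinus, h]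

theorem minusMinus_le_choose {a m t : ℕ} (h : a < Nat.choose (m + 1) (t + 1)) :
    minusMinus a (t + 1) ≤ Nat.choose m t := by
  induction t generalizing a m with
  | zero => simpa using minusMinus_one_le a
  | succ t ih =>
    rcases Nat.eq_zero_or_pos a with rfl | ha
    · simp [minusMinus_zero]
    obtain ⟨k, s, hk, hs, rfl⟩ := exists_eq_choose_succ_add ha (t + 1)
    have hkm : k + 1 < m + 1 := lt_of_choose_lt_choose (t := t + 1 + 1) (by omega)
    rw [minusMinus_choose_add hs hk]
    have h1 := ih hs
    have h2 : Nat.choose (k + 1) (t + 1) ≤ Nat.choose m (t + 1) :=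
      Nat.choose_le_choose _ (by omega)
    have h3 : Nat.choose (k + 1) (t + 1) = Nat.choose k t + Nat.choose k (t + 1) :=
      Nat.choose_succ_succ _ _
    omega

theorem minusMinus_mono {a b : ℕ} (h : a ≤ b) (t : ℕ) : minusMinus a t ≤ minusMinus b t := by
  induction t generalizing a b with
  | zero => simp [minusMinus]
  | succ t ih =>
    rcases Nat.eq_zero_or_pos a with rfl | ha
    · simp [minusMinus_zero]
    obtain ⟨k, s, hk, hs, rfl⟩ := exists_eq_choose_succ_add ha t
    obtain ⟨l, u, hl, hu, rfl⟩ := exists_eq_choose_succ_add (ha.trans_le h) t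
    rw [minusMinus_choose_add hu hl]
    have h3 : Nat.choose (l + 1 + 1) (t + 1) =
        Nat.choose (l + 1) t + Nat.choose (l + 1) (t + 1) := Nat.choose_succ_succ _ _
    have hkl : k + 1 < l + 1 + 1 := lt_of_choose_lt_choose (t := t + 1) (by omega)
    rcases eq_or_lt_of_le (show k ≤ l by omega) with rfl | hlt
    · rw [minusMinus_choose_add hs hk]
      have := ih (show s ≤ u by omega)
      omega
    · have h4 : Nat.choose (k + 1 + 1) (t + 1) =
        Nat.choose (k + 1) t + Nat.choose (k + 1) (t + 1) := Nat.choose_succ_succ _ _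
      have h5 := Nat.choose_le_choose t (show k + 1 ≤ l by omega)
      have h6 := minusMinus_le_choose (a := Nat.choose (k + 1) (t + 1) + s) (m := k + 1) (t := t)
        (by omega)
      omega

theorem minusMinus_plusPlus (a t : ℕ) :
    minusMinus (plusPlus a (t + 1)) (t + 2) = a := by
  induction t generalizing a with
  | zero =>
    rcases Nat.eq_zero_or_pos a with rfl | ha
    · simp [plusPlus_zero, minusMinus_zero]
    obtain ⟨k, s, hk, hs, rfl⟩ := exists_eq_choose_succ_add ha 0
    obtain rfl : s = 0 := by simpa using hs
    rw [plusPlus_choose_add hs, plusPlus_zero, minusMinus_choose_add (by simp) (by omega)]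
    simp [minusMinus_zero]
  | succ t ih =>
    rcases Nat.eq_zero_or_pos a with rfl | ha
    · simp [plusPlus_zero, minusMinus_zero]
    obtain ⟨k, s, hk, hs, rfl⟩ := exists_eq_choose_succ_add ha (t + 1)
    rw [plusPlus_choose_add hs, minusMinus_choose_add (plusPlus_lt_choose hs) (by omega), ih]

theorem le_plusPlus_minusMinus (b t : ℕ) :
    b ≤ plusPlus (minusMinus b (t + 2)) (t + 1) := by
  induction t generalizing b with
  | zero =>
    rcases Nat.eq_zero_or_pos b with rfl | hb
    · simp
    obtain ⟨k, s, hk, hs, rfl⟩ := exists_eq_choose_succ_add hb 1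
    rw [minusMinus_choose_add hs hk]
    rcases Nat.eq_zero_or_pos s with rfl | hs0
    · rw [minusMinus_zero, plusPlus_choose_add (by simp)]
      simp
    · have h1 : minusMinus s 1 = 1 := by simp [minusMinus, hs0.ne']
      have h2 : Nat.choose k 1 + 1 = Nat.choose (k + 1) 1 + 0 := by simp
      rw [h1, h2, plusPlus_choose_add (by simp)]
      have h3 : Nat.choose (k + 1 + 1) 2 = Nat.choose (k + 1) 1 + Nat.choose (k + 1) 2 :=
        Nat.choose_succ_succ _ _
      show Nat.choose (k + 1) 2 + s ≤ Nat.choose (k + 1 + 1) 2 + _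
      omega
  | succ t ih =>
    rcases Nat.eq_zero_or_pos b with rfl | hb
    · simp
    obtain ⟨k, s, hk, hs, rfl⟩ := exists_eq_choose_succ_add hb (t + 2)
    rw [minusMinus_choose_add hs hk]
    rcases eq_or_lt_of_le (minusMinus_le_choose hs) with h | h
    · have h1 : Nat.choose k (t + 2) + minusMinus s (t + 2) =
          Nat.choose (k + 1) (t + 1 + 1) + 0 := by
        rw [h, add_comm]
        exact (Nat.choose_succ_succ _ _).symm
      rw [h1, plusPlus_choose_add (Nat.choose_pos (by omega))]
      have h3 : Nat.choose (k + 1 + 1) (t + 3) =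
          Nat.choose (k + 1) (t + 2) + Nat.choose (k + 1) (t + 3) := Nat.choose_succ_succ _ _
      show Nat.choose (k + 1) (t + 3) + s ≤ Nat.choose (k + 1 + 1) (t + 3) + _
      omega
    · rw [plusPlus_choose_add h]
      exact Nat.add_le_add_left (ih s) _

theorem minusMinus_le_of_le_plusPlus {a b t : ℕ} (ht : 1 ≤ t) (h : b ≤ plusPlus a t) :
    minusMinus b (t + 1) ≤ a := by
  obtain ⟨t, rfl⟩ : ∃ l, t = l + 1 := ⟨t - 1, by omega⟩
  exact (minusMinus_mono h _).trans (minusMinus_plusPlus a t).le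

theorem minusMinus_pos {a : ℕ} (ha : 0 < a) (t : ℕ) : 0 < minusMinus a (t + 1) := by
  obtain ⟨k, s, hk, hs, rfl⟩ := exists_eq_choose_succ_add ha t
  rw [minusMinus_choose_add hs hk]
  exact Nat.add_pos_left (Nat.choose_pos hk) _

theorem minusMinus_one_of_pos {a : ℕ} (ha : 0 < a) : minusMinus a 1 = 1 :=
  le_antisymm (minusMinus_one_le a) (minusMinus_pos ha 0)

/-! ### Values of a Gotzmann polynomial at `t ≥ r` -/

/-- `C(t+k₁,k₁) + C(t-1+k₂,k₂) + ...`, the sum underlying the Gotzmann form. -/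
def gotzmannSum : List ℕ → ℕ → ℕ
  | [], _ => 0
  | k :: ks, t => Nat.choose (t + k) t + gotzmannSum ks (t - 1)

theorem gotzmannSum_lt {ks : List ℕ} (hks : ks.Pairwise (· ≥ ·)) {k t : ℕ}
    (hk : ∀ l ∈ ks, l ≤ k) (ht : ks.length ≤ t) :
    gotzmannSum ks t < Nat.choose (t + k + 1) t := by
  induction ks generalizing k t with
  | nil => exact Nat.choose_pos (by omega)
  | cons l ks ih =>
    rw [List.pairwise_cons] at hks
    obtain ⟨t, rfl⟩ : ∃ u, t = u + 1 := ⟨t - 1, by simp at ht; omega⟩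
    have h1 := ih hks.2 (k := l) (t := t) hks.1 (by simpa using ht)
    have h2 : Nat.choose (t + l + 1 + 1) (t + 1) =
        Nat.choose (t + l + 1) t + Nat.choose (t + l + 1) (t + 1) := Nat.choose_succ_succ _ _
    have h3 : Nat.choose (t + l + 1 + 1) (t + 1) ≤ Nat.choose (t + 1 + k + 1) (t + 1) :=
      Nat.choose_le_choose _ (by have := hk l (by simp); omega)
    have h4 : t + 1 + l = t + l + 1 := by ring
    simp only [gotzmannSum, Nat.add_sub_cancel, h4]
    omega

theorem plusPlus_gotzmannSum {ks : List ℕ} (hks : ks.Pairwise (· ≥ ·)) {t : ℕ}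
    (ht : ks.length ≤ t) : plusPlus (gotzmannSum ks t) t = gotzmannSum ks (t + 1) := by
  induction ks generalizing t with
  | nil => simp [gotzmannSum, plusPlus_zero]
  | cons k ks ih =>
    rw [List.pairwise_cons] at hks
    obtain ⟨t, rfl⟩ : ∃ u, t = u + 1 := ⟨t - 1, by simp at ht; omega⟩
    have hlen : ks.length ≤ t := by simpa using ht
    have h1 := gotzmannSum_lt hks.2 hks.1 hlen
    have h4 : t + 1 + k = t + k + 1 := by ring
    have h5 : t + 1 + 1 + k = t + k + 1 + 1 := by ring
    simp only [gotzmannSum, Nat.add_sub_cancel, h4, h5]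
    rw [plusPlus_choose_add h1, ih hks.2 hlen]

theorem sum_zchoose_eq_gotzmannSum (ks : List ℕ) (t : ℕ) (ht : ks.length ≤ t) :
    ∑ i ∈ Finset.range ks.length, zchoose ((t : ℤ) + (ks.getD i 0 : ℤ) - i) (ks.getD i 0) =
      gotzmannSum ks t := by
  induction ks generalizing t with
  | nil => simp [gotzmannSum]
  | cons k ks ih =>
    obtain ⟨t, rfl⟩ : ∃ u, t = u + 1 := ⟨t - 1, by simp at ht; omega⟩
    rw [List.length_cons, Finset.sum_range_succ']
    have h1 : zchoose ((t + 1 : ℕ) + (k : ℤ)) k = (Nat.choose (t + 1 + k) (t + 1) : ℤ) := by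
      have h2 : ((t + 1 : ℕ) + (k : ℤ)) = ((t + 1 + k : ℕ) : ℤ) := by push_cast; ring
      rw [h2, zchoose, if_pos (Int.natCast_nonneg _), Int.toNat_natCast,
        Nat.choose_symm_add]
    simp only [gotzmannSum, List.getD_cons_succ, List.getD_cons_zero, Nat.add_sub_cancel,
      Nat.cast_add, ← ih t (by simpa using ht)]
    refine (add_comm _ _).trans (congrArg₂ _ ?_ ?_)
    · simpa using h1
    · refine Finset.sum_congr rfl fun i _ => ?_
      congr 1
      push_cast
      ring

namespace GotzmannPoly

theorem eval_natCast (p : GotzmannPoly) {t : ℕ} (ht : p.r ≤ t) :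
    p.eval t = gotzmannSum p.ks t :=
  sum_zchoose_eq_gotzmannSum p.ks t ht

theorem plusPlus_eval (p : GotzmannPoly) {t : ℕ} (ht : p.r ≤ t) :
    (plusPlus (p.eval t).toNat t : ℤ) = p.eval (t + 1 : ℕ) := by
  rw [p.eval_natCast ht, p.eval_natCast (by omega), Int.toNat_natCast,
    plusPlus_gotzmannSum p.sorted ht]

theorem one_le_eval (p : GotzmannPoly) (hr : 0 < p.r) {t : ℕ} (ht : p.r ≤ t) :
    1 ≤ p.eval t := by
  rw [p.eval_natCast ht]
  obtain ⟨ks, hks⟩ := p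
  cases ks with
  | nil => simp [r] at hr
  | cons k ks =>
    have : 0 < Nat.choose (t + k) t := Nat.choose_pos (by omega)
    simp only [gotzmannSum]
    omega

end GotzmannPoly

/-! ### The set `Π_p` and the number `ρ_p` -/

theorem mem_PiSet_iff {p : GotzmannPoly} {t : ℕ} :
    t ∈ PiSet p ↔ 1 ≤ t ∧ t ≤ p.r ∧ ∀ s : ℕ, t ≤ s →
      p.eval (s + 1 : ℕ) ≤ (plusPlus (p.eval s).toNat s : ℤ) ∧ 1 ≤ p.eval (s + 1 : ℕ) := by
  refine and_congr_right fun _ => and_congr_right fun _ => ⟨fun h s hs => ?_, fun h k => ?_⟩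
  · obtain ⟨k, rfl⟩ := Nat.exists_eq_add_of_le hs
    simpa using h k
  · simpa using h (t + k) (Nat.le_add_right _ _)

theorem r_mem_PiSet {p : GotzmannPoly} (hr : 0 < p.r) : p.r ∈ PiSet p :=
  mem_PiSet_iff.2 ⟨hr, le_rfl, fun _ hs =>
    ⟨(p.plusPlus_eval hs).ge, p.one_le_eval hr (by omega)⟩⟩

theorem rhoP_le_of_mem {p : GotzmannPoly} {t : ℕ} (ht : t ∈ PiSet p) : rhoP p ≤ t := by
  unfold rhoP
  split_ifs
  · exact Nat.zero_le _
  · exact Nat.sInf_le ht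

theorem sInf_PiSet_le {p : GotzmannPoly} {t : ℕ} (ht : rhoP p ≤ t) (ht1 : 1 ≤ t) :
    sInf (PiSet p) ≤ t := by
  unfold rhoP at ht
  split_ifs at ht with h
  · exact h.1.le.trans ht1
  · exact ht

theorem eval_succ_le_plusPlus {p : GotzmannPoly} (hr : 0 < p.r) {t : ℕ} (ht : rhoP p ≤ t)
    (ht1 : 1 ≤ t) : p.eval (t + 1 : ℕ) ≤ (plusPlus (p.eval t).toNat t : ℤ) :=
  ((mem_PiSet_iff.1 (Nat.sInf_mem ⟨_, r_mem_PiSet hr⟩)).2.2 t (sInf_PiSet_le ht ht1)).1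

theorem one_le_eval_of_rhoP_le {p : GotzmannPoly} (hr : 0 < p.r) {t : ℕ} (ht : rhoP p ≤ t)
    (ht1 : 1 ≤ t) : 1 ≤ p.eval t := by
  have h := (mem_PiSet_iff.1 (Nat.sInf_mem ⟨_, r_mem_PiSet hr⟩)).2.2 t (sInf_PiSet_le ht ht1)
  by_contra! hlt
  have h0 : (p.eval t).toNat = 0 := by omega
  rw [h0, plusPlus_zero] at h
  omega

theorem eval_zero_of_rhoP_eq_zero {p : GotzmannPoly} (hr : 0 < p.r) (h : rhoP p = 0) :
    p.eval 0 = 1 := by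
  have hm := (mem_PiSet_iff.1 (Nat.sInf_mem ⟨_, r_mem_PiSet hr⟩)).1
  unfold rhoP at h
  split_ifs at h with hc
  · exact hc.2
  · omega

/-! ### Admissible functions and minimal functions -/

theorem OSeq.minusMinus_le {H : ℕ → ℤ} (hH : OSeq H) (t : ℕ) :
    (minusMinus (H (t + 1)).toNat (t + 1) : ℤ) ≤ H t := by
  rcases Nat.eq_zero_or_pos t with rfl | ht
  · rw [hH.2.1]
    exact_mod_cast minusMinus_one_le _
  · have h1 := hH.2.2 t ht
    have h2 := minusMinus_le_of_le_plusPlus (a := (H t).toNat) (b := (H (t + 1)).toNat) ht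
      (by omega)
    have h3 := hH.1 t
    omega

theorem OSeq.eq_zero_of_le {H : ℕ → ℤ} (hH : OSeq H) {s t : ℕ} (hs1 : 1 ≤ s) (hst : s ≤ t)
    (hs : H s = 0) : H t = 0 := by
  induction t, hst using Nat.le_induction with
  | base => exact hs
  | succ t hst ih =>
    have h1 := hH.2.2 t (hs1.trans hst)
    have h2 := hH.1 (t + 1)
    rw [ih, Int.toNat_zero, plusPlus_zero] at h1
    omega

theorem rhoP_le_of_OSeq {p : GotzmannPoly} (hr : 0 < p.r) {H : ℕ → ℤ} (hH : OSeq H) {ρ : ℕ}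
    (hp : ∀ t : ℕ, ρ ≤ t → H t = p.eval t) : rhoP p ≤ ρ := by
  rcases le_or_gt p.r ρ with hρ | hρ
  · exact (rhoP_le_of_mem (r_mem_PiSet hr)).trans hρ
  have hmem : max ρ 1 ∈ PiSet p := by
    refine mem_PiSet_iff.2 ⟨le_max_right _ _, max_le hρ.le hr, fun s hs => ?_⟩
    have hs' := max_le_iff.1 hs
    rw [← hp s hs'.1, ← hp (s + 1) (by omega)]
    refine ⟨hH.2.2 s hs'.2, ?_⟩
    by_contra! hlt
    have hz := hH.eq_zero_of_le (s := s + 1) (t := s + 1 + p.r) (by omega) (by omega)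
      (le_antisymm (by omega) (hH.1 _))
    rw [hp _ (by omega)] at hz
    have := p.one_le_eval hr (t := s + 1 + p.r) (by omega)
    omega
  rcases Nat.eq_zero_or_pos ρ with rfl | hρ0
  · have h0 : p.eval 0 = 1 := by
      have := hp 0 le_rfl
      rw [hH.2.1] at this
      exact this.symm
    have h1 : sInf (PiSet p) = 1 := le_antisymm (Nat.sInf_le (by simpa using hmem))
      (mem_PiSet_iff.1 (Nat.sInf_mem ⟨_, hmem⟩)).1
    simp [rhoP, h0, h1]
  · exact rhoP_le_of_mem (by rwa [max_eq_left hρ0] at hmem)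

theorem fmin_of_le {p : GotzmannPoly} {ρ t : ℕ} (h : ρ ≤ t) : fmin p ρ t = p.eval t := by
  rw [fmin, dif_pos h]

theorem fmin_of_lt {p : GotzmannPoly} {ρ t : ℕ} (h : t < ρ) :
    fmin p ρ t = (minusMinus (fmin p ρ (t + 1)).toNat (t + 1) : ℤ) := by
  rw [fmin, dif_neg (not_le.2 h)]

theorem fmin_le {p : GotzmannPoly} {ρ : ℕ} {H : ℕ → ℤ}
    (h1 : ∀ t : ℕ, ρ ≤ t → p.eval t ≤ H t)
    (h2 : ∀ t : ℕ, t < ρ → (minusMinus (H (t + 1)).toNat (t + 1) : ℤ) ≤ H t) (t : ℕ) :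
    fmin p ρ t ≤ H t := by
  rcases le_or_gt ρ t with h | h
  · rw [fmin_of_le h]
    exact h1 t h
  · induction h.le using Nat.decreasingInduction with
    | self => rw [fmin_of_le le_rfl]; exact h1 ρ le_rfl
    | of_succ t ht ih =>
      rw [fmin_of_lt ht]
      refine le_trans ?_ (h2 t ht)
      have h3 : fmin p ρ (t + 1) ≤ H (t + 1) := by
        rcases Nat.lt_or_ge (t + 1) ρ with h | h
        · exact ih h
        · rw [fmin_of_le h]; exact h1 _ h
      exact_mod_cast minusMinus_mono (Int.toNat_le_toNat h3) _

theorem one_le_fmin {p : GotzmannPoly} (hr : 0 < p.r) {ρ : ℕ} (hρ : rhoP p ≤ ρ) (t : ℕ) :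
    1 ≤ fmin p ρ t := by
  have hge : ∀ s, ρ ≤ s → 1 ≤ fmin p ρ s := fun s hs => by
    rw [fmin_of_le hs]
    rcases Nat.eq_zero_or_pos s with rfl | hs0
    · exact (eval_zero_of_rhoP_eq_zero hr (by omega)).ge
    · exact one_le_eval_of_rhoP_le hr (hρ.trans hs) hs0
  rcases le_total ρ t with h | h
  · exact hge t h
  · induction h using Nat.decreasingInduction with
    | self => exact hge ρ le_rfl
    | of_succ t ht ih =>
      rw [fmin_of_lt ht]
      exact_mod_cast minusMinus_pos (a := (fmin p ρ (t + 1)).toNat) (by omega) t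

theorem OSeq_fmin {p : GotzmannPoly} (hr : 0 < p.r) {ρ : ℕ} (hρ : rhoP p ≤ ρ) :
    OSeq (fmin p ρ) := by
  refine ⟨fun t => zero_le_one.trans (one_le_fmin hr hρ t), ?_, fun t ht => ?_⟩
  · rcases Nat.eq_zero_or_pos ρ with rfl | hρ0
    · rw [fmin_of_le le_rfl]
      exact eval_zero_of_rhoP_eq_zero hr (by omega)
    · have h1 := one_le_fmin hr hρ 1
      rw [fmin_of_lt hρ0]
      exact_mod_cast minusMinus_one_of_pos (a := (fmin p ρ 1).toNat) (by omega)
  · rcases le_or_gt ρ t with h | h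
    · rw [fmin_of_le h, fmin_of_le (by omega)]
      exact eval_succ_le_plusPlus hr (hρ.trans h) ht
    · obtain ⟨t, rfl⟩ : ∃ l, t = l + 1 := ⟨t - 1, by omega⟩
      rw [fmin_of_lt h, Int.toNat_natCast]
      have := le_plusPlus_minusMinus (fmin p ρ (t + 1 + 1)).toNat t
      show _ ≤ ((plusPlus (minusMinus (fmin p ρ (t + 1 + 1)).toNat (t + 2)) (t + 1) : ℕ) : ℤ)
      omega

theorem fmin_succ_le {p : GotzmannPoly} (hr : 0 < p.r) {ρ : ℕ} (hρ : rhoP p ≤ ρ) (t : ℕ) :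
    fmin p (ρ + 1) t ≤ fmin p ρ t :=
  fmin_le (fun s hs => (fmin_of_le (by omega)).ge)
    (fun s _ => (OSeq_fmin hr hρ).minusMinus_le s) t

theorem exists_isRegOf {p : GotzmannPoly} {H : ℕ → ℤ} {ρ : ℕ}
    (hp : ∀ t : ℕ, ρ ≤ t → H t = p.eval t) : ∃ ρ' ≤ ρ, IsRegOf p H ρ' :=
  have hex : ∃ σ : ℕ, ∀ t : ℕ, σ ≤ t → H t = p.eval t := ⟨ρ, hp⟩
  ⟨Nat.find hex, Nat.find_min' hex hp, Nat.find_spec hex, fun _ h => Nat.find_min' hex h⟩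

/-- Proposition `prop:minimalfunction`.
For every `ρ_p ≤ ρ ≤ r-1`: (1) `f^ρ_p` is admissible, hence `ρ_p` is the minimal regularity
among admissible functions with Hilbert polynomial `p`; (2) `f^ρ_p ⪰ f^{ρ+1}_p`;
(3) `f^ρ_p` is the pointwise-minimal admissible function with Hilbert polynomial `p` and
regularity at most `ρ`; (4) `f^{ρ_p}_p` has regularity exactly `ρ_p`;
(5) if `ρ > ρ_p` then `f^ρ_p(ρ-1) ≤ p(ρ-1)`. -/
theorem statement2 (p : GotzmannPoly) (hr : 1 < p.r) (ρ : ℕ)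
    (hρ1 : rhoP p ≤ ρ) (hρ2 : ρ ≤ p.r - 1) :
    (OSeq (fmin p ρ) ∧
      ∀ (H : ℕ → ℤ) (ρ' : ℕ), OSeq H → IsRegOf p H ρ' → rhoP p ≤ ρ') ∧
    (∀ t : ℕ, fmin p (ρ + 1) t ≤ fmin p ρ t) ∧
    ((∃ ρ'' : ℕ, ρ'' ≤ ρ ∧ IsRegOf p (fmin p ρ) ρ'') ∧
      ∀ (H : ℕ → ℤ) (ρ' : ℕ), OSeq H → IsRegOf p H ρ' → ρ' ≤ ρ →
        ∀ t : ℕ, fmin p ρ t ≤ H t) ∧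
    IsRegOf p (fmin p (rhoP p)) (rhoP p) ∧
    (rhoP p < ρ → fmin p ρ (ρ - 1) ≤ p.eval ((ρ : ℤ) - 1)) := by
  have hr0 : 0 < p.r := by omega
  refine ⟨⟨OSeq_fmin hr0 hρ1, fun H ρ' hH hreg => rhoP_le_of_OSeq hr0 hH hreg.1⟩,
    fmin_succ_le hr0 hρ1, ⟨exists_isRegOf fun t ht => fmin_of_le ht, fun H ρ' hH hreg hle =>
      fmin_le (fun t ht => (hreg.1 t (hle.trans ht)).ge) fun t _ => hH.minusMinus_le t⟩,
    ⟨fun t ht => fmin_of_le ht, fun ρ' h => rhoP_le_of_OSeq hr0 (OSeq_fmin hr0 le_rfl) h⟩,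
    fun hlt => ?_⟩
  obtain ⟨σ, rfl⟩ : ∃ σ, ρ = σ + 1 := ⟨ρ - 1, by omega⟩
  have h := fmin_succ_le hr0 (show rhoP p ≤ σ by omega) σ
  rw [fmin_of_le (p := p) (le_refl σ)] at h
  simpa using h
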